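/- arXiv:2509.00273 — 2 statements merged into one kernel-verified Lean document; each statement's English description precedes it below -/
import Mathlib

section
/- Let ℓ and p be distinct primes with ℓ ≡ p ≡ 1 (mod 4), ℓ ≠ 5, and suppose the multiplicative order of p modulo ℓ equals 4. Then H_ℓ is not maximal over any finite extension of 𝔽_p; that is, for every n ≥ 1 and q = p^n, #{(x,y) ∈ 𝔽_{q²} × 𝔽_{q²} : y² = φ_ℓ(x)} ≠ q² + (ℓ−1)q. -/
open Polynomial

/-- Number of affine points (x,y) ∈ F × F with y² = φ_d(x), where φ_d is the
d-th Chebyshev (Dickson first kind, parameter 1) polynomial over F. -/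
noncomputable def chebAffineCount (F : Type) [Field F] (d : ℕ) : ℕ :=
  Nat.card {xy : F × F // xy.2 ^ 2 = (dickson 1 (1 : F) d).eval xy.1}

/-- The hyperelliptic curve H_d : y² = φ_d(x) is maximal over the field with q² elements:
its affine point count attains q² + (d-1)q (Hasse–Weil bound minus the point at infinity). -/
def chebMaximal (d q : ℕ) : Prop :=
  ∀ (F : Type) [Field F] [Fintype F], Fintype.card F = q ^ 2 →
    chebAffineCount F d = q ^ 2 + (d - 1) * q



lemma nt_exists_short (l p : ℕ) (hl : l.Prime) (hl4 : l % 4 = 1) (hl5 : l ≠ 5)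
    (hpl : (l : ℤ) ∣ (p : ℤ) ^ 2 + 1) :
    ∃ (j : ℕ) (j' : ℤ), 0 < j ∧ 4 * j < l ∧ 4 * j' < l ∧ -(l : ℤ) < 4 * j' ∧
      (l : ℤ) ∣ p * j - j' := by
  have := Fact.mk hl
  obtain ⟨a, b, hab⟩ := Nat.Prime.sq_add_sq (p := l) (by omega)
  have hl13 : 13 ≤ l := by
    by_contra h
    have : l < 13 := by omega
    interval_cases l <;> simp_all +decide
  have hsq : ∀ c : ℕ, l ≠ c ^ 2 := by
    intro c hc
    rw [hc] at hl
    exact (Nat.Prime.not_prime_pow (le_refl 2)) hl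
  have ha : 0 < a := by
    rcases Nat.eq_zero_or_pos a with h | h
    · subst h; exact absurd (by simpa using hab.symm) (hsq b)
    · exact h
  have hb : 0 < b := by
    rcases Nat.eq_zero_or_pos b with h | h
    · subst h; exact absurd (by simpa using hab.symm) (hsq a)
    · exact h
  have ha4 : 4 * a < l := by
    by_cases h : a ≤ 3
    · omega
    · push Not at h; nlinarith
  have hb4 : 4 * b < l := by
    by_cases h : b ≤ 3
    · omega
    · push Not at h; nlinarith
  have hdiv : (l : ℤ) ∣ (p * b - a) * (p * b - (-a)) := by
    have h1 : ((p : ℤ) * b - a) * (p * b - (-a)) = ((p:ℤ) ^ 2 + 1) * b ^ 2 - l := by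
      rw [← hab]; push_cast; ring
    rw [h1]
    exact dvd_sub (Dvd.dvd.mul_right hpl _) (dvd_refl _)
  rcases (Nat.prime_iff_prime_int.mp hl).dvd_or_dvd hdiv with h | h
  · exact ⟨b, a, hb, hb4, by omega, by omega, h⟩
  · exact ⟨b, -a, hb, hb4, by omega, by omega, h⟩

/-- two base-p digits -/
lemma nt_digits (l p : ℕ) (hl : l.Prime) (hp4 : p % 4 = 1)
    (hpl : (l : ℤ) ∣ (p : ℤ) ^ 2 + 1) (j j' : ℤ) (h1 : 4 * j < l) (h1' : -(l:ℤ) < 4 * j)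
    (h2 : 4 * j' < l) (h2' : -(l : ℤ) < 4 * j') (h3 : (l : ℤ) ∣ p * j - j') :
    ∃ d1 d0 : ℕ, d1 ≤ (p - 1) / 2 ∧ d0 ≤ (p - 1) / 2 ∧
      4 * (l : ℤ) * (p * d1 + d0) = l * ((p:ℤ) ^ 2 - 1) + 4 * j * ((p:ℤ) ^ 2 + 1) := by
  have hl0 : (0 : ℤ) < l := by exact_mod_cast hl.pos
  obtain ⟨r, hr⟩ : ∃ r : ℕ, p = 4 * r + 1 := ⟨p / 4, by omega⟩
  have h4 : (l : ℤ) ∣ p * j' + j := by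
    have : (p : ℤ) * j' + j = (p ^ 2 + 1) * j - p * (p * j - j') := by ring
    rw [this]
    exact dvd_sub (Dvd.dvd.mul_right hpl _) (Dvd.dvd.mul_left h3 _)
  obtain ⟨c, hc⟩ := h3
  obtain ⟨c', hc'⟩ := h4
  have hpr : (p : ℤ) = 4 * r + 1 := by exact_mod_cast hr
  have hr0 : (0 : ℤ) ≤ r := by positivity
  have bd : ∀ x y c : ℤ, 4 * x < l → -(l:ℤ) < 4 * x → 4 * y < l → -(l:ℤ) < 4 * y →
      p * x + y = l * c → c ≤ r ∧ -r ≤ c := by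
    intro x y c hx hx' hy hy' h
    constructor
    · by_contra hh
      have : (r : ℤ) + 1 ≤ c := by omega
      have h5 : (l : ℤ) * (r + 1) ≤ l * c := by gcongr
      have h6 : (p : ℤ) * (4 * x) ≤ p * l := by gcongr
      nlinarith
    · by_contra hh
      have : c ≤ -(r : ℤ) - 1 := by omega
      have h5 : (l : ℤ) * c ≤ l * (-r - 1) := by gcongr
      have h6 : (p : ℤ) * (-l) ≤ p * (4 * x) := by gcongr
      nlinarith
  have hcb := bd j (-j') c h1 h1' (by omega) (by omega) (by linarith)
  have hcb' := bd j' j c' h2 h2' h1 h1' hc'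
  refine ⟨(r + c).toNat, (r + c').toNat, by omega, by omega, ?_⟩
  rw [Int.toNat_of_nonneg (by omega), Int.toNat_of_nonneg (by omega)]
  have : (l:ℤ) * (p * (r + c) + (r + c')) = l * (p * r + r) + p * (l * c) + l * c' := by ring
  have : 4 * (l:ℤ) * (p * (r + c) + (r + c')) = l * (p * (4 * r) + 4 * r) + 4 * (p * (l * c) + l * c') := by ring
  rw [this, ← hc, ← hc', show (4 * r : ℤ) = p - 1 by omega]
  ring

lemma nt_lucas_step (p : ℕ) (hp : p.Prime) (A B a b : ℕ) (ha : a < p) (hb : b ≤ a)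
    (h : ¬ p ∣ A.choose B) : ¬ p ∣ (p * A + a).choose (p * B + b) := by
  have := Fact.mk hp
  have := Choose.choose_modEq_choose_mod_mul_choose_div_nat (p := p) (n := p * A + a) (k := p * B + b)
  rw [Nat.mul_add_mod, Nat.mul_add_mod, Nat.mod_eq_of_lt ha, Nat.mod_eq_of_lt (by omega),
    Nat.mul_add_div hp.pos, Nat.mul_add_div hp.pos, Nat.div_eq_of_lt ha,
    Nat.div_eq_of_lt (by omega : b < p)] at this
  simp only [add_zero] at this
  rw [this.dvd_iff (dvd_refl p), hp.dvd_mul]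
  rintro (h' | h')
  · have h6 := Nat.choose_mul_factorial_mul_factorial hb
    have : p ∣ a.factorial := by
      rw [← h6, mul_assoc]; exact Dvd.dvd.mul_right h' _
    rw [hp.dvd_factorial] at this
    omega
  · exact h h'

lemma nt_index (l p : ℕ) (hl : l.Prime) (hp : p.Prime) (hp4 : p % 4 = 1)
    (hpl : (l : ℤ) ∣ (p : ℤ) ^ 2 + 1) (j j' : ℤ) (h1 : 4 * j < l) (h1' : -(l:ℤ) < 4 * j)
    (h2 : 4 * j' < l) (h2' : -(l : ℤ) < 4 * j') (h3 : (l : ℤ) ∣ p * j - j') (m : ℕ) :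
    ∃ I : ℕ, 4 * (l : ℤ) * I = l * ((p:ℤ) ^ (2 * m) - 1) + 4 * j * ((p:ℤ) ^ (2 * m) - (-1) ^ m) ∧
      ¬ p ∣ ((p ^ (2 * m) - 1) / 2).choose I := by
  induction m with
  | zero => exact ⟨0, by simp, by simpa using hp.one_lt.ne'⟩
  | succ m ih =>
    obtain ⟨I, hI, hch⟩ := ih
    obtain ⟨d1, d0, hd1, hd0, hd⟩ : ∃ d1 d0 : ℕ, d1 ≤ (p - 1) / 2 ∧ d0 ≤ (p - 1) / 2 ∧
      4 * (l : ℤ) * (p * d1 + d0) = l * ((p:ℤ) ^ 2 - 1) + 4 * ((-1) ^ m * j) * ((p:ℤ) ^ 2 + 1) := by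
      rcases neg_one_pow_eq_or ℤ m with h | h <;> rw [h]
      · exact nt_digits l p hl hp4 hpl (1 * j) j' (by omega) (by omega) h2 h2' (by simpa using h3)
      · refine nt_digits l p hl hp4 hpl (-1 * j) (-j') (by omega) (by omega) (by omega) (by omega) ?_
        have : (p : ℤ) * (-1 * j) - -j' = -(p * j - j') := by ring
        rw [this]; exact (dvd_neg).mpr h3
    refine ⟨p * (p * I + d1) + d0, ?_, ?_⟩
    · push_cast
      have : 4 * (l:ℤ) * (p * (p * I + d1) + d0) = p ^ 2 * (4 * l * I) + 4 * l * (p * d1 + d0) := by ring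
      rw [this, hI, hd]; ring
    · have hN : (p ^ (2 * (m + 1)) - 1) / 2 = p * (p * ((p ^ (2 * m) - 1) / 2) + (p - 1) / 2) + (p - 1) / 2 := by
        have hodd : (p ^ (2 * m)) % 2 = 1 := Nat.odd_iff.mp ((Nat.odd_iff.mpr (by omega)).pow)
        obtain ⟨s, hs⟩ : ∃ s, p ^ (2 * m) = 2 * s + 1 := ⟨p ^ (2*m) / 2, by omega⟩
        obtain ⟨r, hr⟩ : ∃ r : ℕ, p = 2 * r + 1 := ⟨p / 2, by omega⟩
        have e1 : p ^ (2 * (m + 1)) = 2 * (p * (p * s + r) + r) + 1 := by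
          rw [mul_add, pow_add, hs]
          rw [hr]; ring
        rw [e1, hs]
        have e2 : (p - 1) / 2 = r := by omega
        have e3 : (2 * s + 1 - 1) / 2 = s := by omega
        rw [e2, e3]; omega
      rw [hN]
      have := hp.two_le
      exact nt_lucas_step p hp _ _ _ _ (by omega) hd0 (nt_lucas_step p hp _ _ _ _ (by omega) hd1 hch)


abbrev AInt := integralClosure ℤ ℂ

lemma exists_red (p : ℕ) [Fact p.Prime] : ∃ (k : Type) (_ : Field k) (_ : CharP k p),
    Nonempty (AInt →+* k) := by
  have hnu : ¬ IsUnit ((p : ℕ) : AInt) := by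
    intro hu
    obtain ⟨b, hb⟩ := hu.exists_right_inv
    have hbi : IsIntegral ℤ (b : ℂ) := b.2
    have hb' : (b : ℂ) = algebraMap ℚ ℂ ((p : ℚ)⁻¹) := by
      have := congrArg (fun x : AInt => (x : ℂ)) hb
      simp at this
      simp
      exact eq_inv_of_mul_eq_one_right this
    rw [hb', isIntegral_algebraMap_iff (algebraMap ℚ ℂ).injective] at hbi
    obtain ⟨y, hy⟩ := IsIntegrallyClosed.isIntegral_iff.mp hbi
    have hp0 : (p : ℚ) ≠ 0 := by exact_mod_cast (Fact.out : p.Prime).ne_zero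
    have : (p : ℤ) * y = 1 := by
      have : (p : ℚ) * (y : ℚ) = 1 := by
        rw [show (y : ℚ) = (p : ℚ)⁻¹ by simpa using hy]; field_simp
      exact_mod_cast this
    have h2 := (Fact.out : p.Prime).two_le
    have := Int.isUnit_iff.mp (IsUnit.of_mul_eq_one _ this)
    omega
  obtain ⟨P, hP, hpP⟩ := exists_max_ideal_of_mem_nonunits (show (p : AInt) ∈ nonunits AInt from hnu)
  let := Ideal.Quotient.field P
  refine ⟨AInt ⧸ P, inferInstance, ?_, ⟨Ideal.Quotient.mk P⟩⟩
  refine (CharP.charP_iff_prime_eq_zero Fact.out).2 ?_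
  rw [← map_natCast (Ideal.Quotient.mk P)]
  exact Ideal.Quotient.eq_zero_iff_mem.mpr hpP

lemma exists_teich (p : ℕ) [Fact p.Prime] (K : Type) [Field K] [Fintype K] [CharP K p] :
    ∃ (k : Type) (_ : Field k) (ω : MulChar K AInt) (red : AInt →+* k) (ι : K →+* k),
      ∀ v, red (ω v) = ι v := by
  classical
  obtain ⟨k0, _, _, ⟨red0⟩⟩ := exists_red p
  let : Algebra (ZMod p) K := ZMod.algebra K p
  let : Algebra (ZMod p) (AlgebraicClosure k0) :=
    ((algebraMap k0 (AlgebraicClosure k0)).comp (ZMod.castHom (dvd_refl p) k0)).toAlgebra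
  let ι : K →+* AlgebraicClosure k0 := (IsAlgClosed.lift (R := ZMod p) (S := K) (M := AlgebraicClosure k0)).toRingHom
  let red : AInt →+* AlgebraicClosure k0 := (algebraMap k0 (AlgebraicClosure k0)).comp red0
  obtain ⟨g, hg⟩ := IsCyclic.exists_generator (α := Kˣ)
  set m := Fintype.card Kˣ with hm
  have hm0 : 0 < m := Fintype.card_pos
  have hprim := Complex.isPrimitiveRoot_exp m hm0.ne'
  set ζ := Complex.exp (2 * Real.pi * Complex.I / m)
  have hζi : IsIntegral ℤ ζ := hprim.isIntegral hm0
  have hprim' : IsPrimitiveRoot (⟨ζ, hζi⟩ : AInt) m := by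
    refine IsPrimitiveRoot.of_map_of_injective (f := algebraMap AInt ℂ) ?_ Subtype.val_injective
    exact hprim
  have hX := X_pow_sub_one_eq_prod hm0 hprim'
  have h0 : ∏ z ∈ nthRootsFinset m (1 : AInt), (ι g - red z) = 0 := by
    have := congrArg (fun f => eval₂ red (ι g) f) hX
    simp only [eval₂_sub, eval₂_pow, eval₂_X, eval₂_one, eval₂_finsetProd, eval₂_C] at this
    rw [← this, ← map_pow, ← Units.val_pow_eq_pow_val, hm, pow_card_eq_one]
    simp
  obtain ⟨z, hz, hz0⟩ := Finset.prod_eq_zero_iff.mp h0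
  rw [mem_nthRootsFinset hm0] at hz
  let zu : AIntˣ := Units.ofPowEqOne z m hz hm0.ne'
  have hzu : zu ∈ rootsOfUnity m AInt := by
    rw [mem_rootsOfUnity]; ext; simp [zu]
  refine ⟨AlgebraicClosure k0, inferInstance, MulChar.ofRootOfUnity hzu hg, red, ι, ?_⟩
  intro v
  by_cases hv : v = 0
  · subst hv; rw [MulCharClass.map_nonunit (MulChar.ofRootOfUnity hzu hg) not_isUnit_zero, map_zero, map_zero]
  · obtain ⟨i, hi⟩ := (mem_powers_iff_mem_zpowers.mpr (hg (Units.mk0 v hv)))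
    have hi' : v = (g : K) ^ i := by
      have := congrArg Units.val hi
      simpa using this.symm
    rw [hi', map_pow, MulChar.ofRootOfUnity_spec, map_pow, map_pow]
    congr 1
    exact (sub_eq_zero.mp hz0).symm


lemma all_eq_of_sum_eq {α : Type*} (s : Finset α) (z : α → ℂ) (B : ℝ) (h : ∀ i ∈ s, ‖z i‖ ≤ B)
    (hs : ∑ i ∈ s, z i = (s.card : ℂ) * B) : ∀ i ∈ s, z i = B := by
  have hre : ∑ i ∈ s, (z i).re = ∑ i ∈ s, B := by
    have := congrArg Complex.re hs
    simpa using this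
  have h1 : ∀ i ∈ s, (z i).re = B :=
    (Finset.sum_eq_sum_iff_of_le (fun i hi => (Complex.re_le_norm _).trans (h i hi))).mp hre
  intro i hi
  have h2 := h1 i hi
  have h3 := h i hi
  have h4 : ‖z i‖ = (z i).re := le_antisymm (h2 ▸ h3) (Complex.re_le_norm _)
  have h5 : (z i).im = 0 := by
    have h6 := Complex.sq_norm (z i)
    rw [h4, Complex.normSq_apply] at h6
    nlinarith
  apply Complex.ext <;> simp [h2, h5]

/-- Orthogonality: summing over `l`-th powers. -/
lemma sum_pow_eq_sum_char {K : Type} [Field K] [Fintype K] [DecidableEq K] (l e : ℕ) (hl : l.Prime)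
    (he : Fintype.card Kˣ = l * e) (ρ : MulChar K ℂ) (hρ : ρ ^ l = 1) (hρ1 : ρ ≠ 1) (h : Kˣ → ℂ) :
    ∑ v : Kˣ, h (v ^ l) = ∑ k ∈ Finset.range l, ∑ v : Kˣ, (ρ ^ k) v * h v := by
  obtain ⟨g, hg⟩ := IsCyclic.exists_generator (α := Kˣ)
  have hord : orderOf g = l * e := by
    rw [orderOf_eq_card_of_forall_mem_zpowers hg, Nat.card_eq_fintype_card, he]
  have he0 : e ≠ 0 := by
    rintro rfl
    have : 0 < Fintype.card Kˣ := Fintype.card_pos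
    omega
  have hgl : IsPrimitiveRoot (g ^ e) l := by
    have := (IsPrimitiveRoot.orderOf g).pow (by rw [hord]; exact Nat.mul_pos hl.pos (Nat.pos_of_ne_zero he0))
      (show orderOf g = e * l by rw [hord, mul_comm])
    exact this
  have hρg : IsPrimitiveRoot (ρ g) l := by
    have h1 : (ρ g) ^ l = 1 := by
      rw [← MulChar.pow_apply' _ hl.ne_zero, hρ, MulChar.one_apply_coe]
    have h2 : ρ g ≠ 1 := by
      intro h; apply hρ1
      rw [MulChar.eq_iff hg, h, MulChar.one_apply_coe]
    have := Fact.mk hl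
    exact (orderOf_eq_prime h1 h2) ▸ IsPrimitiveRoot.orderOf (ρ g)
  rw [Finset.sum_comm]
  have hfib : ∑ v : Kˣ, h (v ^ l) = ∑ w : Kˣ, ∑ v : Kˣ with v ^ l = w, h w := by
    rw [← Finset.sum_fiberwise Finset.univ (fun v : Kˣ => v ^ l)]
    refine Finset.sum_congr rfl fun w _ => Finset.sum_congr rfl fun v hv => ?_
    rw [(Finset.mem_filter.mp hv).2]
  rw [hfib]
  refine Finset.sum_congr rfl fun w _ => ?_
  rw [Finset.sum_const, nsmul_eq_mul, ← Finset.sum_mul]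
  congr 1
  have hpw : ∀ k, (ρ ^ k) w = (ρ w) ^ k := fun k => MulChar.pow_apply_coe _ _ _
  simp only [hpw]
  obtain ⟨i, rfl⟩ := mem_powers_iff_mem_zpowers.mpr (hg w)
  simp only [Units.val_pow_eq_pow_val, map_pow]
  by_cases hi : l ∣ i
  · obtain ⟨r, rfl⟩ := hi
    simp only [pow_mul, hρg.pow_eq_one]
    simp only [one_pow, Finset.sum_const, Finset.card_range, nsmul_eq_mul, mul_one]
    have hc : Nat.card (rootsOfUnity l K) = l := by
      have : NeZero l := ⟨hl.ne_zero⟩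
      exact hgl.card_rootsOfUnity'
    congr 1
    refine Eq.trans ?_ hc
    rw [← Fintype.card_subtype, ← Nat.card_eq_fintype_card]
    refine Nat.card_congr ((Equiv.mulRight ((g ^ r)⁻¹)).subtypeEquiv fun x => ?_)
    rw [Equiv.coe_mulRight, mem_rootsOfUnity, mul_pow, inv_pow, ← pow_mul, ← pow_mul, mul_comm r l,
      mul_inv_eq_one]
  · have hne : ρ g ^ i ≠ 1 := fun h => hi (hρg.pow_eq_one_iff_dvd i |>.mp h)
    rw [geom_sum_eq hne, ← pow_mul, mul_comm, pow_mul, hρg.pow_eq_one]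
    simp only [one_pow, sub_self, zero_div, Nat.cast_eq_zero, Finset.card_eq_zero]
    rw [Finset.filter_eq_empty_iff]
    intro v _ hv
    obtain ⟨r, rfl⟩ := mem_powers_iff_mem_zpowers.mpr (hg v)
    apply hne
    rw [← map_pow, ← Units.val_pow_eq_pow_val]
    simp only at hv
    rw [← hv]
    simp only [Units.val_pow_eq_pow_val, map_pow]
    rw [← pow_mul, mul_comm, pow_mul, hρg.pow_eq_one, one_pow]

lemma final_lemma (p l : ℕ) [Fact p.Prime] (hl : l.Prime) (K : Type) [Field K] [Fintype K]
    [DecidableEq K] [CharP K p] (h : Kˣ → ℤ) (c D N M I j B : ℕ)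
    (hK : Fintype.card K - 1 = c * D) (hD : D = l * M) (hND : 2 * N ≤ D)
    (hh : ∀ v : Kˣ, (h v : K) = ((v : K) ^ (2 * c) + 1) ^ N * (v : K) ^ (c * (D - N)))
    (hI : 2 * I = N + 2 * j * M) (hIN : I ≤ N) (hI2 : 2 * I < D) (hI3 : 2 * N < D + 2 * I) (hj : 0 < j) (hjl : 2 * j < l)
    (hch : ¬ p ∣ N.choose I)
    (hb : ∀ ρ : MulChar K ℂ, ρ ^ l = 1 → ρ ≠ 1 → ‖∑ v : Kˣ, ρ v * (h v : ℂ)‖ ≤ B)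
    (hsum : ∑ v : Kˣ, (h (v ^ l) - h v) = ((l : ℤ) - 1) * B) (hpB : p ∣ B) : False := by
  obtain ⟨k, _, ω, red, ι, hω⟩ := exists_teich p K
  have hKu : Fintype.card Kˣ = c * D := by rw [Fintype.card_units, hK]
  have hcD : 0 < c * D := hKu ▸ Fintype.card_pos
  have hM0 : 0 < M := by
    rcases Nat.eq_zero_or_pos M with h | h
    · subst h; simp [hD] at hcD
    · exact h
  have hc0 : 0 < c := Nat.pos_of_mul_pos_right hcD
  set ρ0 : MulChar K AInt := ω ^ (c * M) with hρ0
  let emb : AInt →+* ℂ := algebraMap AInt ℂ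
  have hemb : Function.Injective emb := Subtype.val_injective
  let ρ : MulChar K ℂ := ρ0.ringHomComp emb
  have hρv : ∀ v : Kˣ, ρ v = emb (ω v) ^ (c * M) := by
    intro v
    simp only [ρ, hρ0, MulChar.ringHomComp_apply, MulChar.pow_apply_coe, map_pow]
  have hωcard : ∀ v : Kˣ, (ω v) ^ (c * D) = 1 := by
    intro v
    rw [← map_pow, ← Units.val_pow_eq_pow_val, ← hKu, pow_card_eq_one]; simp
  have hρl : ρ ^ l = 1 := by
    ext v
    rw [MulChar.pow_apply_coe, hρv, MulChar.one_apply_coe, ← pow_mul, ← map_pow,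
      show c * M * l = c * D by rw [hD]; ring, hωcard, map_one]
  obtain ⟨g, hg⟩ := IsCyclic.exists_generator (α := Kˣ)
  have hord : orderOf g = c * D := by
    rw [orderOf_eq_card_of_forall_mem_zpowers hg, Nat.card_eq_fintype_card, hKu]
  have hρk : ∀ k, 0 < k → k < l → ρ ^ k ≠ 1 := by
    intro k hk hkl h1
    have h2 : (ρ ^ k) g = 1 := by rw [h1, MulChar.one_apply_coe]
    rw [MulChar.pow_apply_coe, hρv, ← pow_mul, ← map_pow, ← map_one emb] at h2
    have h3 := congrArg red (hemb h2)
    rw [map_pow, hω, map_one, ← map_pow, ← map_one ι] at h3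
    have h4 : g ^ (c * M * k) = 1 := by
      ext; simpa using ι.injective h3
    have h5 := orderOf_dvd_of_pow_eq_one h4
    rw [hord, hD, show c * (l * M) = c * M * l by ring] at h5
    have h6 := Nat.dvd_of_mul_dvd_mul_left (Nat.mul_pos hc0 hM0) h5
    exact absurd (Nat.le_of_dvd hk h6) (by omega)
  have hρ1 : ρ ≠ 1 := by simpa using hρk 1 one_pos hl.one_lt
  have hexp := sum_pow_eq_sum_char l (c * M) hl (by rw [hKu, hD]; ring) ρ hρl hρ1
    (fun v => (h v : ℂ))
  have hl1 := hl.two_le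
  have htot : ∑ k ∈ Finset.Ico 1 l, ∑ v : Kˣ, (ρ ^ k) v * (h v : ℂ) =
      ((Finset.Ico 1 l).card : ℂ) * (B : ℝ) := by
    rw [Finset.range_eq_Ico, Finset.sum_eq_sum_Ico_succ_bot hl.pos] at hexp
    have h0 : ∑ v : Kˣ, (ρ ^ 0) v * (h v : ℂ) = ∑ v : Kˣ, (h v : ℂ) := by
      refine Finset.sum_congr rfl fun v _ => ?_
      rw [pow_zero, MulChar.one_apply_coe, one_mul]
    have h1 := congrArg (Int.cast : ℤ → ℂ) hsum
    push_cast [Finset.sum_sub_distrib] at h1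
    rw [h0] at hexp
    rw [Nat.card_Ico, Nat.cast_sub (by omega)]
    push_cast
    rw [← h1, hexp]
    simp
  have hall := all_eq_of_sum_eq _ _ _ (fun k hk => by
    rw [Finset.mem_Ico] at hk
    refine hb (ρ ^ k) ?_ (hρk k (by omega) hk.2)
    rw [← pow_mul, mul_comm, pow_mul, hρl, one_pow]) htot
  have hT := hall (l - 2 * j) (by rw [Finset.mem_Ico]; omega)
  set k' := l - 2 * j with hk'
  have hTA : ∑ v : Kˣ, (ω v) ^ (c * M * k') * ((h v : ℤ) : AInt) = (B : AInt) := by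
    apply hemb
    rw [map_sum, map_natCast]
    have : ((B : ℝ) : ℂ) = (B : ℂ) := by simp
    rw [← this, ← hT]
    refine Finset.sum_congr rfl fun v _ => ?_
    rw [map_mul, MulChar.pow_apply_coe, hρv, ← pow_mul, map_intCast, map_pow]
  have hTk := congrArg red hTA
  rw [map_sum, map_natCast, ← map_natCast ι, (CharP.cast_eq_zero_iff K p B).mpr hpB] at hTk
  have hTK : ∑ v : Kˣ, (v : K) ^ (c * M * k') * ((h v : ℤ) : K) = 0 := by
    apply ι.injective
    rw [map_sum, ← hTk]
    refine Finset.sum_congr rfl fun v _ => ?_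
    rw [map_mul, map_mul, map_pow, map_pow, hω, map_intCast, map_intCast]
  have hfin : ∑ v : Kˣ, (v : K) ^ (c * M * k') * ((h v : ℤ) : K) = - (N.choose I : K) := by
    have h1 : ∀ v : Kˣ, (v : K) ^ (c * M * k') * ((h v : ℤ) : K) =
        ∑ i ∈ Finset.range (N + 1), (N.choose i : K) * (v : K) ^ (c * (M * k' + (D - N) + 2 * i)) := by
      intro v
      rw [hh, add_pow, Finset.sum_mul, Finset.mul_sum]
      refine Finset.sum_congr rfl fun i _ => ?_
      rw [one_pow, ← pow_mul]
      ring
    simp only [h1]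
    rw [Finset.sum_comm]
    simp only [← Finset.mul_sum]
    rw [Finset.sum_eq_single I]
    · rw [FiniteField.sum_pow_units, hK, if_pos, mul_neg_one]
      apply Nat.mul_dvd_mul_left
      refine ⟨2, ?_⟩
      zify [show N ≤ D by omega, hjl.le, hk'] at *
      rw [hI, hD]; ring
    · intro i hi hiI
      rw [Finset.mem_range] at hi
      rw [FiniteField.sum_pow_units, hK, if_neg, mul_zero]
      intro hd
      have hd2 := Nat.dvd_of_mul_dvd_mul_left hc0 hd
      have hd3 : (D : ℤ) ∣ 2 * ((i : ℤ) - I) := by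
        have h3 : ((M * k' + (D - N) + 2 * i : ℕ) : ℤ) = 2 * D + 2 * ((i : ℤ) - I) := by
          have hI' : 2 * (I : ℤ) = N + 2 * j * M := by exact_mod_cast hI
          have hD' : (D : ℤ) = l * M := by exact_mod_cast hD
          push_cast [hk', Nat.cast_sub (show N ≤ D by omega), Nat.cast_sub hjl.le]
          linear_combination hI' - hD'
        have h4 : (D : ℤ) ∣ ((M * k' + (D - N) + 2 * i : ℕ) : ℤ) := by exact_mod_cast hd2
        rw [h3] at h4
        exact (dvd_add_right (Dvd.intro_left _ rfl)).mp h4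
      have := Int.eq_zero_of_abs_lt_dvd hd3 (by rw [abs_lt]; constructor <;> omega)
      omega
    · intro hh; exact absurd (Finset.mem_range.mpr (by omega)) hh
  rw [hfin, neg_eq_zero, CharP.cast_eq_zero_iff K p] at hTK
  exact hch hTK


/-- complex-valued quadratic character -/
noncomputable def qchi (K : Type) [Field K] [Fintype K] [DecidableEq K] : MulChar K ℂ :=
  (quadraticChar K).ringHomComp (Int.castRingHom ℂ)

section quad
variable {K : Type} [Field K] [Fintype K] [DecidableEq K]

lemma qchi_apply (a : K) : qchi K a = (quadraticChar K a : ℂ) := rfl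

lemma qchi_sq : (qchi K) ^ 2 = 1 := by
  ext v
  rw [MulChar.pow_apply_coe, qchi_apply, MulChar.one_apply_coe, ← Int.cast_pow,
    quadraticChar_sq_one v.ne_zero]
  simp

lemma qchi_ne_one (hK : ringChar K ≠ 2) : qchi K ≠ 1 := by
  intro h
  obtain ⟨a, ha⟩ := quadraticChar_exists_neg_one' hK
  have := congrArg (fun f : MulChar K ℂ => f a) h
  simp only [qchi_apply, ha, MulChar.one_apply_coe] at this
  norm_num at this

lemma eq_qchi (hK : ringChar K ≠ 2) (μ : MulChar K ℂ) (h2 : μ ^ 2 = 1) (h1 : μ ≠ 1) :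
    μ = qchi K := by
  obtain ⟨g, hg⟩ := IsCyclic.exists_generator (α := Kˣ)
  have key : ∀ μ : MulChar K ℂ, μ ^ 2 = 1 → μ ≠ 1 → μ g = -1 := by
    intro μ h2 h1
    have h3 : (μ g) ^ 2 = 1 := by rw [← MulChar.pow_apply_coe, h2, MulChar.one_apply_coe]
    have h4 : (μ g - 1) * (μ g + 1) = 0 := by linear_combination h3
    rcases mul_eq_zero.mp h4 with h | h
    · exact absurd ((MulChar.eq_iff hg μ 1).mpr (by rw [sub_eq_zero.mp h, MulChar.one_apply_coe])) h1
    · exact eq_neg_of_add_eq_zero_left h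
  rw [MulChar.eq_iff hg, key μ h2 h1, key _ qchi_sq (qchi_ne_one hK)]

lemma exists_theta (hK : Fintype.card K % 4 = 1) (l : ℕ) (hl : l % 2 = 1) (ρ : MulChar K ℂ)
    (hρ : ρ ^ l = 1) : ∃ θ : MulChar K ℂ, θ ^ 2 = ρ * qchi K ∧ θ ^ 2 ≠ 1 := by
  have hK2 : ringChar K ≠ 2 := by
    intro h
    have := FiniteField.even_card_of_char_two h
    omega
  obtain ⟨κ, hκ⟩ := MulChar.exists_mulChar_orderOf K (n := 4) (R := ℂ)
    (by omega) (Complex.isPrimitiveRoot_exp 4 (by norm_num))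
  have hκ2 : κ ^ 2 = qchi K := by
    apply eq_qchi hK2
    · rw [← pow_mul]; norm_num; rw [← hκ]; exact pow_orderOf_eq_one κ
    · intro h
      have := orderOf_dvd_of_pow_eq_one h
      rw [hκ] at this
      omega
  obtain ⟨r, hr⟩ : ∃ r, l = 2 * r + 1 := ⟨l / 2, by omega⟩
  have hsq : (ρ ^ (r + 1) * κ) ^ 2 = ρ * qchi K := by
    rw [mul_pow, hκ2, ← pow_mul, show (r + 1) * 2 = l + 1 by omega, pow_succ, hρ, one_mul]
  refine ⟨ρ ^ (r + 1) * κ, hsq, ?_⟩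
  rw [hsq]
  intro h
  have h3 : (ρ * qchi K) ^ l = qchi K := by
    rw [mul_pow, hρ, one_mul, hr, pow_succ, pow_mul, qchi_sq, one_pow, one_mul]
  rw [h, one_pow] at h3
  exact qchi_ne_one hK2 h3.symm

lemma sum_units_eq (f : K → ℂ) (h0 : f 0 = 0) : ∑ v : Kˣ, f v = ∑ v : K, f v := by
  rw [← Finset.sum_erase_add (a := (0 : K)) _ _ (Finset.mem_univ _), h0, add_zero]
  refine Finset.sum_bij (fun v _ => (v : K)) (by simp) (fun a _ b _ h => Units.ext h) ?_ (by simp)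
  intro b hb
  exact ⟨Units.mk0 b (Finset.ne_of_mem_erase hb), Finset.mem_univ _, rfl⟩

lemma sum_squares (hK : ringChar K ≠ 2) (f : K → ℂ) :
    ∑ v : K, f (v ^ 2) = ∑ w : K, f w + ∑ w : K, qchi K w * f w := by
  rw [← Finset.sum_fiberwise Finset.univ (fun v : K => v ^ 2), ← Finset.sum_add_distrib]
  refine Finset.sum_congr rfl fun w _ => ?_
  have h1 : ∑ i with i ^ 2 = w, f (i ^ 2) = ∑ i : K with i ^ 2 = w, f w := by
    refine Finset.sum_congr rfl fun v hv => ?_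
    rw [(Finset.mem_filter.mp hv).2]
  rw [h1, Finset.sum_const, nsmul_eq_mul]
  have h2 := congrArg (Int.cast : ℤ → ℂ) (quadraticChar_card_sqrts hK w)
  have h3 : ({x : K | x ^ 2 = w}.toFinset) = Finset.univ.filter (fun x : K => x ^ 2 = w) := by
    ext; simp
  rw [h3] at h2
  push_cast at h2
  rw [h2, qchi_apply]
  ring

lemma norm_gauss (χ : MulChar K ℂ) (hχ : χ ≠ 1) (ψ : AddChar K ℂ) (hψ : ψ.IsPrimitive) :
    ‖gaussSum χ ψ‖ = √(Fintype.card K) := by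
  have h := gaussSum_mul_gaussSum_eq_card hχ hψ
  rw [← star_gaussSum_eq, Complex.star_def, Complex.mul_conj] at h
  have h' : Complex.normSq (gaussSum χ ψ) = Fintype.card K := by exact_mod_cast h
  rw [← h', Complex.normSq_eq_norm_sq, Real.sqrt_sq (norm_nonneg _)]

lemma norm_jacobi (χ φ : MulChar K ℂ) (hχ : χ ≠ 1) (hφ : φ ≠ 1) (hχφ : χ * φ ≠ 1) :
    ‖jacobiSum χ φ‖ = √(Fintype.card K) := by
  have hc : ringChar ℂ ≠ ringChar K := by
    rw [ringChar.eq_zero]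
    exact (CharP.ringChar_ne_zero_of_finite K).symm
  have h := jacobiSum_mul_jacobiSum_inv hc hχ hφ hχφ
  have hs : star (jacobiSum χ φ) = jacobiSum χ⁻¹ φ⁻¹ := by
    simp only [jacobiSum, star_sum, star_mul', MulChar.star_apply']
  rw [← hs, Complex.star_def, Complex.mul_conj] at h
  have h' : Complex.normSq (jacobiSum χ φ) = Fintype.card K := by exact_mod_cast h
  rw [← h', Complex.normSq_eq_norm_sq, Real.sqrt_sq (norm_nonneg _)]

lemma norm_shift_jacobi (hK : ringChar K ≠ 2) (θ : MulChar K ℂ) (hθ : θ ^ 2 ≠ 1) :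
    ‖∑ w : K, θ w * qchi K (w + 1)‖ = √(Fintype.card K) := by
  have h1 : ∑ w : K, θ w * qchi K (w + 1) = θ (-1) * jacobiSum θ (qchi K) := by
    rw [jacobiSum, ← Equiv.sum_comp (Equiv.neg K), Finset.mul_sum]
    refine Finset.sum_congr rfl fun w _ => ?_
    rw [Equiv.neg_apply, ← mul_assoc, ← map_mul, neg_one_mul, neg_add_eq_sub]
  have h2 : ‖θ (-1)‖ = 1 := by
    apply Complex.norm_eq_one_of_pow_eq_one (n := 2) _ (by norm_num)
    rw [← map_pow]; simp
  rw [h1, norm_mul, h2, one_mul]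
  refine norm_jacobi _ _ ?_ (qchi_ne_one hK) ?_
  · rintro rfl; simp at hθ
  · intro h
    apply hθ
    have := congrArg (· ^ 2) h
    simpa [mul_pow, qchi_sq] using this

lemma bound_F (hK : Fintype.card K % 4 = 1) (l : ℕ) (hl : l % 2 = 1) (ρ : MulChar K ℂ)
    (hρ : ρ ^ l = 1) :
    ‖∑ t : Kˣ, ρ t * ((quadraticChar K ((t : K) + (t : K)⁻¹) : ℤ) : ℂ)‖ ≤ 2 * √(Fintype.card K) := by
  have hK2 : ringChar K ≠ 2 := by
    intro h
    have := FiniteField.even_card_of_char_two h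
    omega
  obtain ⟨θ, hθ, hθ1⟩ := exists_theta hK l hl ρ hρ
  have h1 : ∀ t : Kˣ, ρ t * ((quadraticChar K ((t : K) + (t : K)⁻¹) : ℤ) : ℂ) =
      θ ((t : K) ^ 2) * qchi K ((t : K) ^ 2 + 1) := by
    intro t
    rw [map_pow, ← MulChar.pow_apply_coe, hθ, MulChar.mul_apply, mul_assoc, ← map_mul, ← qchi_apply]
    have : (t : K) * ((t : K) ^ 2 + 1) = (t : K) ^ 2 * ((t : K) + (t : K)⁻¹) := by
      field_simp
    rw [this, map_mul, map_pow, ← MulChar.pow_apply_coe, qchi_sq, MulChar.one_apply_coe, one_mul]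
  simp only [h1]
  rw [sum_units_eq (fun t => θ (t ^ 2) * qchi K (t ^ 2 + 1))
    (by simp [MulChar.map_zero]),
    sum_squares hK2 (fun w => θ w * qchi K (w + 1)), two_mul]
  refine (norm_add_le _ _).trans (add_le_add (norm_shift_jacobi hK2 θ hθ1).le ?_)
  have h2 : ∀ w : K, qchi K w * (θ w * qchi K (w + 1)) = (qchi K * θ) w * qchi K (w + 1) := by
    intro w; rw [MulChar.mul_apply, mul_assoc]
  simp only [h2]
  refine (norm_shift_jacobi hK2 _ ?_).le
  rwa [mul_pow, qchi_sq, one_mul]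

end quad

section ext
variable {F L : Type} [Field F] [Fintype F] [DecidableEq F] [Field L] [Fintype L] [DecidableEq L]
  [Algebra F L]

lemma qchi_norm (hF : ringChar F ≠ 2) (hL : ringChar L ≠ 2) (v : Lˣ) :
    qchi F (Algebra.norm F (v : L)) = qchi L v := by
  let μ : MulChar L ℂ := MulChar.ofUnitHom
    ((MulChar.toUnitHom (qchi F)).comp (Units.map (Algebra.norm F (S := L))))
  have hμ : ∀ v : Lˣ, μ v = qchi F (Algebra.norm F (v : L)) := by
    intro v
    simp [μ, MulChar.coe_toUnitHom]
  rw [← hμ]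
  congr 1
  apply eq_qchi hL
  · ext v
    rw [MulChar.pow_apply_coe, hμ, ← map_pow, ← map_pow, MulChar.one_apply_coe, map_pow, map_pow]
    have := congrArg (fun f : MulChar F ℂ => f (Units.map (Algebra.norm F (S := L)) v)) (qchi_sq (K := F))
    simp only [MulChar.pow_apply_coe, MulChar.one_apply_coe] at this
    exact this
  · intro h
    apply qchi_ne_one hF
    ext a
    obtain ⟨v, hv⟩ := FiniteField.unitsMap_norm_surjective F L a
    rw [MulChar.one_apply_coe, ← hv]
    have := hμ v
    rw [h, MulChar.one_apply_coe] at this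
    exact this.symm

lemma norm_trace_sum (hF : ringChar F ≠ 2) (hc : Fintype.card L = Fintype.card F ^ 2)
    (θ : MulChar L ℂ) (hθ : θ ≠ 1) :
    ‖∑ w : L, θ w * qchi F (Algebra.trace F L w)‖ ≤ (Fintype.card F - 1) * √(Fintype.card F) := by
  obtain ⟨ψ, hψ⟩ : ∃ ψ : AddChar F ℂ, ψ.IsPrimitive := by
    exact ⟨_, AddChar.FiniteField.primitiveChar_to_Complex_isPrimitive F⟩
  let Ψ : AddChar L ℂ := ψ.compAddMonoidHom (Algebra.trace F L).toAddMonoidHom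
  have hΨ : ∀ w, Ψ w = ψ (Algebra.trace F L w) := fun w => rfl
  have hΨp : Ψ.IsPrimitive := by
    apply AddChar.IsPrimitive.of_ne_one
    have h1 : ψ ≠ 1 := by
      have := hψ one_ne_zero
      rwa [AddChar.mulShift_one] at this
    obtain ⟨a, ha⟩ := AddChar.ne_one_iff.mp h1
    obtain ⟨w, hw⟩ := Algebra.trace_surjective F L a
    exact AddChar.ne_one_iff.mpr ⟨w, by rwa [hΨ, hw]⟩
  set Q := Fintype.card F
  have hQ : (0:ℝ) < Q := by exact_mod_cast Fintype.card_pos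
  have hg := norm_gauss (qchi F) (qchi_ne_one hF) ψ hψ
  -- expansion of qchi
  have hexp : ∀ s : F, gaussSum (qchi F) ψ * qchi F s = ∑ c : F, qchi F c * ψ (c * s) := by
    intro s
    by_cases hs : s = 0
    · subst hs
      simp only [mul_zero, AddChar.map_zero_eq_one, mul_one, MulChar.map_zero]
      rw [MulChar.sum_eq_zero_of_ne_one (qchi_ne_one hF)]
    · have := gaussSum_mulShift (qchi F) ψ (Units.mk0 s hs)
      rw [← this, mul_comm, Units.val_mk0, ← mul_assoc, ← sq, ← MulChar.pow_apply' _ two_ne_zero, qchi_sq,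
        MulChar.one_apply (IsUnit.mk0 s hs), one_mul, gaussSum]
      refine Finset.sum_congr rfl fun c _ => ?_
      rw [AddChar.mulShift_apply, mul_comm s c]
  have h1 : gaussSum (qchi F) ψ * ∑ w : L, θ w * qchi F (Algebra.trace F L w) =
      ∑ c : F, qchi F c * ∑ w : L, θ w * Ψ (algebraMap F L c * w) := by
    simp only [Finset.mul_sum]
    rw [Finset.sum_comm]
    refine Finset.sum_congr rfl fun w _ => ?_
    rw [mul_left_comm, hexp, Finset.mul_sum]
    refine Finset.sum_congr rfl fun c _ => ?_
    rw [hΨ, ← Algebra.smul_def, map_smul, smul_eq_mul]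
    ring
  have hLs : √(Fintype.card L : ℝ) = Q := by
    rw [hc]; push_cast; exact Real.sqrt_sq hQ.le
  have h2 : ‖∑ c : F, qchi F c * ∑ w : L, θ w * Ψ (algebraMap F L c * w)‖ ≤ (Q - 1) * Q := by
    rw [← sum_units_eq (fun c => qchi F c * ∑ w : L, θ w * Ψ (algebraMap F L c * w))
      (by simp [MulChar.map_zero])]
    refine (norm_sum_le_of_le (f := fun c : Fˣ => qchi F c * ∑ w : L, θ w * Ψ (algebraMap F L c * w))
      (n := fun _ => (Q : ℝ)) _ ?_).trans ?_
    · intro c _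
      have h3 : ‖qchi F c‖ = 1 := by
        apply Complex.norm_eq_one_of_pow_eq_one (n := 2) _ (by norm_num)
        rw [← MulChar.pow_apply_coe, qchi_sq, MulChar.one_apply_coe]
      rw [norm_mul, h3, one_mul]
      have hc0 : algebraMap F L c ≠ 0 := by simp
      have h4 := gaussSum_mulShift θ Ψ (Units.mk0 _ hc0)
      have h5 : ‖θ (algebraMap F L c)‖ = 1 := by
        apply Complex.norm_eq_one_of_pow_eq_one (n := Fintype.card Lˣ) _ Fintype.card_ne_zero
        have : (θ (Units.mk0 _ hc0 : Lˣ)) ^ Fintype.card Lˣ = 1 := by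
          rw [← map_pow, ← Units.val_pow_eq_pow_val, pow_card_eq_one]; simp
        exact this
      have h6 := congrArg norm h4
      rw [norm_mul, Units.val_mk0, h5, one_mul, norm_gauss θ hθ Ψ hΨp, hLs] at h6
      rw [← h6, gaussSum]
      simp only [AddChar.mulShift_apply]
      exact le_refl _
    · rw [Finset.sum_const, nsmul_eq_mul, Finset.card_univ, Fintype.card_units,
        Nat.cast_sub Fintype.card_pos]
      simp [Q]
  rw [← h1, norm_mul, hg] at h2
  have hsq : √(Q : ℝ) * √Q = Q := Real.mul_self_sqrt hQ.le
  have hs0 : 0 < √(Q : ℝ) := Real.sqrt_pos.mpr hQ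
  refine le_of_mul_le_mul_left ?_ hs0
  calc _ ≤ _ := h2
    _ = _ := by rw [mul_left_comm, hsq]

lemma bound_L (hF4 : Fintype.card F % 4 = 1) (hc : Fintype.card L = Fintype.card F ^ 2)
    (l : ℕ) (hl : l % 2 = 1) (ρ : MulChar L ℂ) (hρ : ρ ^ l = 1) :
    ‖∑ v : Lˣ, ρ v * ((quadraticChar F (Algebra.trace F L ((v : L) ^ 2) / Algebra.norm F (v : L)) : ℤ) : ℂ)‖
      ≤ 2 * ((Fintype.card F - 1) * √(Fintype.card F)) := by
  have hF : ringChar F ≠ 2 := by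
    intro h
    have := FiniteField.even_card_of_char_two h
    omega
  have hL4 : Fintype.card L % 4 = 1 := by rw [hc, Nat.pow_mod, hF4]
  have hL : ringChar L ≠ 2 := by
    intro h
    have := FiniteField.even_card_of_char_two h
    omega
  obtain ⟨θ, hθ, hθ1⟩ := exists_theta hL4 l hl ρ hρ
  have h1 : ∀ v : Lˣ, ρ v * ((quadraticChar F (Algebra.trace F L ((v : L) ^ 2) / Algebra.norm F (v : L)) : ℤ) : ℂ)
     = θ ((v : L) ^ 2) * qchi F (Algebra.trace F L ((v : L) ^ 2)) := by
    intro v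
    rw [map_pow θ, ← MulChar.pow_apply_coe, hθ, MulChar.mul_apply, mul_assoc, ← qchi_apply, ← qchi_norm hF hL,
      ← map_mul]
    have hN : Algebra.norm F (v : L) ≠ 0 := by simp [Algebra.norm_ne_zero_iff]
    have : Algebra.norm F (v : L) * Algebra.trace F L ((v : L) ^ 2) =
      (Algebra.norm F (v : L)) ^ 2 * (Algebra.trace F L ((v : L) ^ 2) / Algebra.norm F (v : L)) := by
      field_simp
    rw [this, map_mul, map_pow (qchi F), ← MulChar.pow_apply' _ two_ne_zero, qchi_sq,
        MulChar.one_apply (IsUnit.mk0 _ hN), one_mul]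
  simp only [h1]
  rw [sum_units_eq (fun t => θ (t ^ 2) * qchi F (Algebra.trace F L (t ^ 2)))
    (by simp [MulChar.map_zero]),
    sum_squares hL (fun w => θ w * qchi F (Algebra.trace F L w)), two_mul]
  refine (norm_add_le _ _).trans (add_le_add (norm_trace_sum hF hc θ ?_) ?_)
  · rintro rfl; simp at hθ1
  have h2 : ∀ w : L, qchi L w * (θ w * qchi F (Algebra.trace F L w)) =
      (qchi L * θ) w * qchi F (Algebra.trace F L w) := by
    intro w; rw [MulChar.mul_apply, mul_assoc]
  simp only [h2]
  refine norm_trace_sum hF hc _ ?_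
  intro h
  have := congrArg (· ^ 2) h
  simp only [mul_pow, qchi_sq, one_mul, one_pow] at this
  exact hθ1 this

end ext


section fiber
variable {F L : Type} [Field F] [Fintype F] [DecidableEq F] [Field L] [Fintype L] [DecidableEq L]
  [Algebra F L]

/-- the element `Tr(v²)/N(v)` -/
noncomputable def xt (F : Type) {L : Type} [Field F] [Field L] [Algebra F L] (v : Lˣ) : F :=
  Algebra.trace F L ((v : L) ^ 2) / Algebra.norm F (v : L)

lemma alg_xt (hc : Fintype.card L = Fintype.card F ^ 2) (v : Lˣ) :
    algebraMap F L (xt F v) =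
      (v : L) ^ (Fintype.card F - 1) + ((v : L) ^ (Fintype.card F - 1))⁻¹ := by
  have hfr : Module.finrank F L = 2 := by
    have := Module.card_eq_pow_finrank (K := F) (V := L)
    rw [hc] at this
    exact (Nat.pow_right_injective (Fintype.one_lt_card (α := F)) this).symm
  obtain ⟨r, hr⟩ : ∃ r, Fintype.card F = r + 1 := ⟨Fintype.card F - 1, by
    have := Fintype.card_pos (α := F); omega⟩
  rw [xt, map_div₀, FiniteField.algebraMap_trace_eq_sum_pow, FiniteField.algebraMap_norm_eq_prod_pow,
    hfr, Nat.card_eq_fintype_card, hr]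
  have hv : (v : L) ≠ 0 := v.ne_zero
  simp only [Finset.sum_range_succ, Finset.prod_range_succ, Finset.sum_range_zero,
    Finset.prod_range_zero, Nat.add_sub_cancel, pow_zero, pow_one, zero_add, one_mul]
  rw [eq_comm, div_eq_mul_inv]
  field_simp
  ring

lemma card_pow_fiber (r : ℕ) (hr : 0 < r) (w : L) :
    (Finset.univ.filter (fun v : Lˣ => (v : L) ^ r = w)).card ≤ r := by
  calc _ = ((Finset.univ.filter (fun v : Lˣ => (v : L) ^ r = w)).image (fun v : Lˣ => (v : L))).card :=
        (Finset.card_image_of_injective _ Units.val_injective).symm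
    _ ≤ (nthRoots r w).toFinset.card := by
        apply Finset.card_le_card
        intro a ha
        simp only [Finset.mem_image, Finset.mem_filter, Finset.mem_univ, true_and] at ha
        obtain ⟨v, hv, rfl⟩ := ha
        rw [Multiset.mem_toFinset, mem_nthRoots hr]
        exact hv
    _ ≤ r := (Multiset.toFinset_card_le _).trans (card_nthRoots _ _)

lemma fiber_le (hc : Fintype.card L = Fintype.card F ^ 2) (x : F) :
    (Fintype.card F - 1) * (Finset.univ.filter (fun t : Fˣ => (t : F) + (t : F)⁻¹ = x)).card +
      (Finset.univ.filter (fun v : Lˣ => xt F v = x)).card ≤ 2 * (Fintype.card F - 1) := by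
  set r := Fintype.card F - 1 with hr
  have hr0 : 0 < r := by have := Fintype.one_lt_card (α := F); omega
  set A := Finset.univ.filter (fun t : Fˣ => (t : F) + (t : F)⁻¹ = x) with hA
  set V := Finset.univ.filter (fun v : Lˣ => xt F v = x) with hV
  set T := A.image (fun t : Fˣ => algebraMap F L t) with hT
  set U := V.image (fun v : Lˣ => (v : L) ^ r) with hU
  have hAT : A.card = T.card := by
    rw [hT, Finset.card_image_of_injective]
    intro a b h
    exact Units.ext ((algebraMap F L).injective h)
  have hVU : V.card ≤ r * U.card := by
    refine Finset.card_le_mul_card_image V r fun w _ => ?_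
    refine le_trans (Finset.card_le_card ?_) (card_pow_fiber r hr0 w)
    intro v hv
    simp only [Finset.mem_filter] at hv ⊢
    exact ⟨Finset.mem_univ _, hv.2⟩
  have hroot : ∀ u ∈ T ∪ U, u ≠ 0 ∧ u + u⁻¹ = algebraMap F L x := by
    intro u hu
    rcases Finset.mem_union.mp hu with h | h
    · obtain ⟨t, ht, rfl⟩ := Finset.mem_image.mp h
      refine ⟨by simp, ?_⟩
      rw [← (Finset.mem_filter.mp ht).2, map_add, map_inv₀]
    · obtain ⟨v, hv, rfl⟩ := Finset.mem_image.mp h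
      refine ⟨by simp, ?_⟩
      rw [← (Finset.mem_filter.mp hv).2, alg_xt hc]
  have hquad : ∀ u ∈ T ∪ U, ∀ w ∈ T ∪ U, w = u ∨ w * u = 1 := by
    intro u hu w hw
    obtain ⟨hu0, hu1⟩ := hroot u hu
    obtain ⟨hw0, hw1⟩ := hroot w hw
    have h1 : u + u⁻¹ = w + w⁻¹ := hu1.trans hw1.symm
    have h2 : (w - u) * (w * u - 1) = 0 := by
      field_simp at h1
      linear_combination - h1
    rcases mul_eq_zero.mp h2 with h | h
    · left; exact sub_eq_zero.mp h
    · right; exact sub_eq_zero.mp h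
  have hcard2 : ∀ u ∈ T ∪ U, T ∪ U ⊆ {u, u⁻¹} := by
    intro u hu w hw
    rw [Finset.mem_insert, Finset.mem_singleton]
    rcases hquad u hu w hw with h | h
    · exact Or.inl h
    · right; exact eq_inv_of_mul_eq_one_left h
  have key : T.card + U.card ≤ 2 := by
    rw [← Finset.card_union_add_card_inter]
    rcases Finset.eq_empty_or_nonempty (T ∩ U) with h | ⟨u, hu⟩
    · rw [h, Finset.card_empty, add_zero]
      rcases Finset.eq_empty_or_nonempty (T ∪ U) with h | ⟨u, hu⟩
      · rw [h]; simp
      · exact (Finset.card_le_card (hcard2 u hu)).trans Finset.card_le_two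
    · have hu' := Finset.mem_inter.mp hu
      have huU : u ∈ T ∪ U := Finset.mem_union_left _ hu'.1
      have hu2 : u⁻¹ = u := by
        obtain ⟨t, ht, htu⟩ := Finset.mem_image.mp hu'.1
        obtain ⟨v, hv, hvu⟩ := Finset.mem_image.mp hu'.2
        have h1 : u ^ r = 1 := by
          rw [← htu, ← map_pow, FiniteField.pow_card_sub_one_eq_one _ t.ne_zero, map_one]
        have h2 : u ^ (r + 2) = 1 := by
          rw [← hvu, ← pow_mul]
          have : r * (r + 2) = Fintype.card L - 1 := by
            rw [hc, show Fintype.card F = r + 1 by omega]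
            rw [show (r + 1) ^ 2 = r * (r + 2) + 1 by ring]; simp
          rw [this, FiniteField.pow_card_sub_one_eq_one _ v.ne_zero]
        rw [pow_add, h1, one_mul, sq] at h2
        exact inv_eq_of_mul_eq_one_left h2
      have h3 := hcard2 u huU
      rw [hu2, Finset.pair_eq_singleton] at h3
      have h4 := Finset.card_le_card h3
      have h5 := Finset.card_le_card ((Finset.inter_subset_left (s₁ := T) (s₂ := U)).trans
        (Finset.subset_union_left.trans h3))
      simp only [Finset.card_singleton] at h4 h5
      omega
  calc r * A.card + V.card ≤ r * T.card + r * U.card := by rw [hAT]; omega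
    _ = r * (T.card + U.card) := by ring
    _ ≤ r * 2 := Nat.mul_le_mul_left _ key
    _ = _ := by ring

lemma fiber_eq (hc : Fintype.card L = Fintype.card F ^ 2) (x : F) :
    (Fintype.card F - 1) * (Finset.univ.filter (fun t : Fˣ => (t : F) + (t : F)⁻¹ = x)).card +
      (Finset.univ.filter (fun v : Lˣ => xt F v = x)).card = 2 * (Fintype.card F - 1) := by
  refine (Finset.sum_eq_sum_iff_of_le (s := Finset.univ) (fun x _ => fiber_le hc x)).mp ?_ x
    (Finset.mem_univ x)
  rw [Finset.sum_add_distrib, ← Finset.mul_sum,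
    ← Finset.card_eq_sum_card_fiberwise (fun _ _ => Finset.mem_univ _),
    ← Finset.card_eq_sum_card_fiberwise (fun _ _ => Finset.mem_univ _),
    Finset.sum_const, Finset.card_univ, Finset.card_univ, Finset.card_univ, Fintype.card_units,
    Fintype.card_units, hc]
  obtain ⟨r, hr⟩ : ∃ r, Fintype.card F = r + 1 := ⟨Fintype.card F - 1, by
    have := Fintype.card_pos (α := F); omega⟩
  rw [hr, show (r + 1) ^ 2 = r * (r + 2) + 1 by ring]
  simp only [Nat.add_sub_cancel, smul_eq_mul]
  ring

lemma sum_fib {α : Type} [Fintype α] (g : α → F) (f : F → ℤ) :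
    ∑ a, f (g a) = ∑ x, ((Finset.univ.filter (fun a => g a = x)).card : ℤ) * f x := by
  rw [← Finset.sum_fiberwise Finset.univ g]
  refine Finset.sum_congr rfl fun w _ => ?_
  rw [← nsmul_eq_mul, ← Finset.sum_const]
  refine Finset.sum_congr rfl fun v hv => ?_
  rw [(Finset.mem_filter.mp hv).2]

lemma fiber_sum (hc : Fintype.card L = Fintype.card F ^ 2) (f : F → ℤ) :
    ((Fintype.card F : ℤ) - 1) * ∑ t : Fˣ, f ((t : F) + (t : F)⁻¹) + ∑ v : Lˣ, f (xt F v) =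
      2 * ((Fintype.card F : ℤ) - 1) * ∑ x, f x := by
  rw [sum_fib (fun t : Fˣ => (t : F) + (t : F)⁻¹), sum_fib (fun v : Lˣ => xt F v), Finset.mul_sum,
    Finset.mul_sum, ← Finset.sum_add_distrib]
  refine Finset.sum_congr rfl fun x _ => ?_
  have := congrArg (Nat.cast : ℕ → ℤ) (fiber_eq hc x)
  push_cast [Nat.cast_sub (Fintype.card_pos (α := F))] at this
  rw [← mul_assoc, ← add_mul]
  congr 1

lemma dick_xt (hc : Fintype.card L = Fintype.card F ^ 2) (l : ℕ) (v : Lˣ) :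
    (dickson 1 (1 : F) l).eval (xt F v) = xt F (v ^ l) := by
  apply (algebraMap F L).injective
  rw [alg_xt hc, ← Polynomial.eval_map_apply, map_dickson, map_one, alg_xt hc,
    dickson_one_one_eval_add_inv _ _ (mul_inv_cancel₀ (by simp))]
  simp only [Units.val_pow_eq_pow_val, inv_pow]
  congr 1
  · ring
  · congr 1; ring

lemma dick_t (l : ℕ) (t : Fˣ) :
    (dickson 1 (1 : F) l).eval ((t : F) + (t : F)⁻¹) =
      ((t ^ l : Fˣ) : F) + ((t ^ l : Fˣ) : F)⁻¹ := by
  rw [dickson_one_one_eval_add_inv _ _ (mul_inv_cancel₀ (by simp))]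
  simp

lemma sum_pow_coprime {G : Type} [CommGroup G] [Fintype G] (l : ℕ) (h : (Nat.card G).Coprime l)
    (f : G → ℤ) : ∑ v : G, f (v ^ l) = ∑ v, f v :=
  Equiv.sum_comp (powCoprime h) f

lemma sum_xt_pow (hc : Fintype.card L = Fintype.card F ^ 2) (l : ℕ)
    (h : l.Coprime (Fintype.card F + 1)) (f : F → ℤ) :
    ∑ v : Lˣ, f (xt F (v ^ l)) = ∑ v : Lˣ, f (xt F v) := by
  set Q := Fintype.card F with hQ
  have hQ1 : 1 < Q := Fintype.one_lt_card
  have hLu : Fintype.card Lˣ = (Q - 1) * (Q + 1) := by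
    rw [Fintype.card_units, hc]
    obtain ⟨r, hr⟩ : ∃ r, Q = r + 1 := ⟨Q - 1, by omega⟩
    rw [hr, show (r + 1) ^ 2 = r * (r + 1 + 1) + 1 by ring]; simp
  have hdvd : (Q + 1) ∣ Fintype.card Lˣ := by rw [hLu]; exact Dvd.intro_left _ rfl
  have : NeZero (Fintype.card Lˣ) := ⟨Fintype.card_ne_zero⟩
  obtain ⟨w, hw⟩ := ZMod.unitsMap_surjective hdvd (ZMod.unitOfCoprime l h)
  set m := (w : ZMod (Fintype.card Lˣ)).val with hm
  have hmc : m.Coprime (Fintype.card Lˣ) := ZMod.val_coe_unit_coprime w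
  have hml : m ≡ l [MOD (Q + 1)] := by
    have h1 := congrArg (Units.val) hw
    rw [ZMod.unitsMap_val, ZMod.coe_unitOfCoprime, ← ZMod.natCast_val,
      ZMod.natCast_eq_natCast_iff] at h1
    exact h1
  rw [← sum_pow_coprime m (by rw [Nat.card_eq_fintype_card]; exact hmc.symm) (fun v => f (xt F v))]
  refine Finset.sum_congr rfl fun v _ => ?_
  congr 1
  apply (algebraMap F L).injective
  rw [alg_xt hc, alg_xt hc]
  have h2 : (v ^ l) ^ (Q - 1) = (v ^ m) ^ (Q - 1) := by
    rw [← pow_mul, ← pow_mul, pow_eq_pow_iff_modEq]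
    refine Nat.ModEq.of_dvd (orderOf_dvd_card) ?_
    rw [hLu, mul_comm l, mul_comm m]
    exact (Nat.ModEq.mul_left' _ hml).symm
  have h3 : ((v ^ l : Lˣ) : L) ^ (Q - 1) = ((v ^ m : Lˣ) : L) ^ (Q - 1) := by
    rw [← Units.val_pow_eq_pow_val, h2, Units.val_pow_eq_pow_val]
  rw [h3]

lemma cast_id {E : Type} [Field E] (u : E) (hu : u ≠ 0) (N D : ℕ) (hND : N ≤ D) (h : u ^ D = 1) :
    (u + u⁻¹) ^ N = (u ^ 2 + 1) ^ N * u ^ (D - N) := by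
  have h1 : u ^ (D - N) = (u ^ N)⁻¹ := by
    apply eq_inv_of_mul_eq_one_left
    rw [← pow_add, Nat.sub_add_cancel hND, h]
  rw [h1, ← div_eq_mul_inv, ← div_pow]
  congr 1
  field_simp

lemma count_eq (hF : ringChar F ≠ 2) (l : ℕ) :
    (chebAffineCount F l : ℤ) = Fintype.card F +
      ∑ x : F, quadraticChar F ((dickson 1 (1 : F) l).eval x) := by
  have h1 : chebAffineCount F l =
      ∑ x : F, (Finset.univ.filter (fun y : F => y ^ 2 = (dickson 1 (1 : F) l).eval x)).card := by
    rw [chebAffineCount, Nat.card_eq_fintype_card, Fintype.card_subtype, Finset.card_filter,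
      Fintype.sum_prod_type]
    refine Finset.sum_congr rfl fun x _ => ?_
    rw [Finset.card_filter]
  rw [h1]
  push_cast
  have h2 : ∀ x : F, ((Finset.univ.filter (fun y : F => y ^ 2 = (dickson 1 (1 : F) l).eval x)).card : ℤ)
      = quadraticChar F ((dickson 1 (1 : F) l).eval x) + 1 := by
    intro x
    rw [← quadraticChar_card_sqrts hF]
    congr 2
    ext; simp
  simp only [h2, Finset.sum_add_distrib]
  simp [add_comm]

end fiber


section core
variable {F L : Type} [Field F] [Fintype F] [DecidableEq F] [Field L] [Fintype L] [DecidableEq L]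
  [Algebra F L]

lemma two_sums (hF : ringChar F ≠ 2) (hc : Fintype.card L = Fintype.card F ^ 2) (l : ℕ) (S : ℤ)
    (hS : ∑ x : F, quadraticChar F ((dickson 1 (1 : F) l).eval x) = S) :
    ((Fintype.card F : ℤ) - 1) * (∑ t : Fˣ, quadraticChar F (((t ^ l : Fˣ) : F) + ((t ^ l : Fˣ) : F)⁻¹)
        - ∑ t : Fˣ, quadraticChar F ((t : F) + (t : F)⁻¹)) +
      (∑ v : Lˣ, quadraticChar F (xt F (v ^ l)) - ∑ v : Lˣ, quadraticChar F (xt F v)) =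
      2 * ((Fintype.card F : ℤ) - 1) * S := by
  have h1 := fiber_sum (L := L) hc (fun x => quadraticChar F ((dickson 1 (1 : F) l).eval x))
  have h2 := fiber_sum (L := L) hc (fun x => quadraticChar F x)
  rw [quadraticChar_sum_zero hF] at h2
  simp only [dick_t, dick_xt hc] at h1
  rw [hS] at h1
  linear_combination h1 - h2

lemma core_even (p l : ℕ) [Fact p.Prime] (hl : l.Prime) (hl2 : l % 2 = 1) [CharP F p] (q j I : ℕ)
    (hq : p ∣ q) (hc : Fintype.card L = Fintype.card F ^ 2) (hFq : Fintype.card F = q ^ 2)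
    (hF4 : Fintype.card F % 4 = 1) (hlQ : l ∣ Fintype.card F - 1)
    (hj : 0 < j) (hjl : 4 * j < l)
    (hI : 4 * (l : ℤ) * I = l * ((Fintype.card F : ℤ) - 1) + 4 * j * ((Fintype.card F : ℤ) - 1))
    (hch : ¬ p ∣ ((Fintype.card F - 1) / 2).choose I)
    (hS : ∑ x : F, quadraticChar F ((dickson 1 (1 : F) l).eval x) = ((l : ℤ) - 1) * q) : False := by
  have hF : ringChar F ≠ 2 := by
    intro h
    have := FiniteField.even_card_of_char_two h
    omega
  have h2 := two_sums (L := L) hF hc l _ hS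
  have hQ1 : 1 < Fintype.card F := Fintype.one_lt_card
  set Q := Fintype.card F with hQ
  have hcop : l.Coprime (Q + 1) := by
    rw [Nat.Prime.coprime_iff_not_dvd hl]
    intro h
    have h3 : l ∣ 2 := by
      have := Nat.dvd_sub h hlQ
      rwa [show Q + 1 - (Q - 1) = 2 by omega] at this
    have := (Nat.prime_dvd_prime_iff_eq hl Nat.prime_two).mp h3
    omega
  rw [sum_xt_pow hc l hcop, sub_self, add_zero] at h2
  have hQ0 : ((Q : ℤ) - 1) ≠ 0 := by omega
  have h3 : ∑ t : Fˣ, (quadraticChar F (((t ^ l : Fˣ) : F) + ((t ^ l : Fˣ) : F)⁻¹)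
        - quadraticChar F ((t : F) + (t : F)⁻¹)) = ((l : ℤ) - 1) * ((2 * q : ℕ) : ℤ) := by
    rw [Finset.sum_sub_distrib]
    apply mul_left_cancel₀ hQ0
    rw [h2]; push_cast; ring
  obtain ⟨M, hM⟩ := hlQ
  have hMz : (Q : ℤ) - 1 = l * M := by
    have := congrArg (Nat.cast : ℕ → ℤ) hM
    push_cast [Nat.cast_sub hQ1.le] at this
    exact this
  have hl0 : (l : ℤ) ≠ 0 := by exact_mod_cast hl.ne_zero
  have hI4 : 4 * I = (Q - 1) + 4 * j * M := by
    zify [hQ1.le]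
    apply mul_left_cancel₀ hl0
    rw [hMz] at hI ⊢
    linear_combination hI
  have hM0 : 0 < M := by
    rcases Nat.eq_zero_or_pos M with h | h
    · subst h; omega
    · exact h
  have hjM : 0 < j * M := Nat.mul_pos hj hM0
  have hjM2 : 4 * (j * M) < Q - 1 := by
    rw [hM, ← mul_assoc]; exact Nat.mul_lt_mul_of_pos_right hjl hM0
  have hI4' : 4 * I = (Q - 1) + 4 * (j * M) := by rw [hI4]; ring
  refine final_lemma p l hl F (fun t => quadraticChar F ((t : F) + (t : F)⁻¹)) 1 (Q - 1) ((Q - 1) / 2)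
    M I j (2 * q) (by rw [one_mul]) hM (by omega) ?_
    (by rw [mul_assoc]; omega) (by omega) (by omega) (by omega) hj (by omega) hch ?_ h3 (Dvd.dvd.mul_left hq 2)
  · intro t
    rw [quadraticChar_eq_pow_of_char_ne_two' hF, ← hQ, show Q / 2 = (Q - 1) / 2 by omega,
      cast_id (t : F) t.ne_zero _ (Q - 1) (by omega)
        (FiniteField.pow_card_sub_one_eq_one _ t.ne_zero), mul_one, one_mul]
  · intro ρ hρ _
    refine (bound_F hF4 l hl2 ρ hρ).trans ?_
    rw [← hQ, hFq]
    push_cast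
    rw [Real.sqrt_sq (by positivity)]

lemma core_odd (p l : ℕ) [Fact p.Prime] (hl : l.Prime) (hl2 : l % 2 = 1) [CharP L p] (q j I : ℕ)
    (hq : p ∣ q) (hc : Fintype.card L = Fintype.card F ^ 2) (hFq : Fintype.card F = q ^ 2)
    (hF4 : Fintype.card F % 4 = 1) (hlQ : l ∣ Fintype.card F + 1)
    (hj : 0 < j) (hjl : 4 * j < l)
    (hI : 4 * (l : ℤ) * I = l * ((Fintype.card F : ℤ) - 1) + 4 * j * ((Fintype.card F : ℤ) + 1))
    (hch : ¬ p ∣ ((Fintype.card F - 1) / 2).choose I)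
    (hS : ∑ x : F, quadraticChar F ((dickson 1 (1 : F) l).eval x) = ((l : ℤ) - 1) * q) : False := by
  have hF : ringChar F ≠ 2 := by
    intro h
    have := FiniteField.even_card_of_char_two h
    omega
  have h2 := two_sums (L := L) hF hc l _ hS
  have hQ1 : 1 < Fintype.card F := Fintype.one_lt_card
  set Q := Fintype.card F with hQ
  have hcop : (Nat.card Fˣ).Coprime l := by
    rw [Nat.coprime_comm, Nat.Prime.coprime_iff_not_dvd hl, Nat.card_eq_fintype_card,
      Fintype.card_units, ← hQ]
    intro h
    have h3 : l ∣ 2 := by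
      have := Nat.dvd_sub hlQ h
      rwa [show Q + 1 - (Q - 1) = 2 by omega] at this
    have := (Nat.prime_dvd_prime_iff_eq hl Nat.prime_two).mp h3
    omega
  rw [sum_pow_coprime l hcop (fun t : Fˣ => quadraticChar F ((t : F) + (t : F)⁻¹)), sub_self,
    mul_zero, zero_add] at h2
  have h3 : ∑ v : Lˣ, (quadraticChar F (xt F (v ^ l)) - quadraticChar F (xt F v))
      = ((l : ℤ) - 1) * ((2 * (Q - 1) * q : ℕ) : ℤ) := by
    rw [Finset.sum_sub_distrib, h2]; push_cast [Nat.cast_sub hQ1.le]; ring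
  obtain ⟨M, hM⟩ := hlQ
  have hMz : (Q : ℤ) + 1 = l * M := by exact_mod_cast hM
  have hl0 : (l : ℤ) ≠ 0 := by exact_mod_cast hl.ne_zero
  have hI4 : 4 * I = (Q - 1) + 4 * j * M := by
    zify [hQ1.le]
    apply mul_left_cancel₀ hl0
    rw [hMz] at hI
    linear_combination hI
  have hM2 : 2 ≤ M := by
    have h5 : M % 2 = 0 := by
      have h6 : (l * M) % 2 = 0 := by omega
      rw [Nat.mul_mod, hl2] at h6
      omega
    rcases Nat.eq_zero_or_pos M with h | h
    · subst h; omega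
    · omega
  have hjM2 : 4 * (j * M) ≤ Q - 1 := by
    have h5 : (4 * j + 1) * M ≤ l * M := Nat.mul_le_mul_right _ (by omega)
    rw [← hM] at h5
    have h6 : (4 * j + 1) * M = 4 * (j * M) + M := by ring
    omega
  have hI4' : 4 * I = (Q - 1) + 4 * (j * M) := by rw [hI4]; ring
  have hcD : Fintype.card L - 1 = (Q - 1) * (Q + 1) := by
    rw [hc]
    obtain ⟨r, hr⟩ : ∃ r, Q = r + 1 := ⟨Q - 1, by omega⟩
    rw [hr, show (r + 1) ^ 2 = r * (r + 1 + 1) + 1 by ring]; simp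
  refine final_lemma p l hl L (fun v => quadraticChar F (xt F v)) (Q - 1) (Q + 1) ((Q - 1) / 2)
    M I j (2 * (Q - 1) * q) hcD hM (by omega) ?_
    (by rw [mul_assoc]; omega) (by omega) (by omega) (by omega) hj (by omega) hch ?_ h3
    (Dvd.dvd.mul_left hq _)
  · intro v
    have h5 : ((quadraticChar F (xt F v) : ℤ) : L) =
        algebraMap F L ((quadraticChar F (xt F v) : ℤ) : F) := by simp
    rw [h5, quadraticChar_eq_pow_of_char_ne_two' hF, ← hQ, show Q / 2 = (Q - 1) / 2 by omega,
      map_pow, alg_xt hc, ← hQ, cast_id ((v : L) ^ (Q - 1)) (by simp) _ (Q + 1) (by omega)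
        (by rw [← pow_mul, ← hcD, FiniteField.pow_card_sub_one_eq_one _ v.ne_zero]),
      ← pow_mul, ← pow_mul, mul_comm (Q - 1) 2]
  · intro ρ hρ _
    refine (bound_L hF4 hc l hl2 ρ hρ).trans ?_
    rw [← hQ, hFq]
    push_cast [Nat.cast_sub (show 1 ≤ q ^ 2 by omega)]
    rw [Real.sqrt_sq (by positivity), mul_assoc]

end core

theorem statement10 (l p : ℕ) (hl : l.Prime) (hl4 : l % 4 = 1) (hl5 : l ≠ 5)
    (hp : p.Prime) (hp4 : p % 4 = 1) (hne : p ≠ l)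
    (u : (ZMod l)ˣ) (hu : (u : ZMod l) = (p : ZMod l))
    (hord : orderOf u = 4) (n : ℕ) (hn : 1 ≤ n) :
    ¬ chebMaximal l (p ^ n) := by
  intro hmax
  have := Fact.mk hl
  have := Fact.mk hp
  have hpl : (l : ℤ) ∣ (p : ℤ) ^ 2 + 1 := by
    have h4 : (p : ZMod l) ^ 4 = 1 := by
      rw [← hu, ← Units.val_pow_eq_pow_val, ← hord, pow_orderOf_eq_one, Units.val_one]
    have h2 : (p : ZMod l) ^ 2 ≠ 1 := by
      intro h
      rw [← hu, ← Units.val_pow_eq_pow_val, Units.val_eq_one] at h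
      have := orderOf_dvd_of_pow_eq_one h
      rw [hord] at this
      omega
    have h3 : ((p : ZMod l) ^ 2 - 1) * ((p : ZMod l) ^ 2 + 1) = 0 := by linear_combination h4
    have h5 := (mul_eq_zero.mp h3).resolve_left (sub_ne_zero.mpr h2)
    rw [← ZMod.intCast_zmod_eq_zero_iff_dvd]
    push_cast
    exact h5
  obtain ⟨j, j', hj, hjl, hj1, hj2, hjj⟩ := nt_exists_short l p hl hl4 hl5 hpl
  obtain ⟨I, hI, hch⟩ := nt_index l p hl hp hp4 hpl j j' (by omega) (by omega) hj1 hj2 hjj n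
  let F := GaloisField p (2 * n)
  let _ : Fintype F := Fintype.ofFinite F
  let _ : DecidableEq F := Classical.decEq F
  have hcF : Fintype.card F = p ^ (2 * n) := by
    rw [← Nat.card_eq_fintype_card]; exact GaloisField.card p (2 * n) (by omega)
  have hcF2 : Fintype.card F = (p ^ n) ^ 2 := by rw [hcF, ← pow_mul, mul_comm]
  let L := FiniteField.Extension F p 2
  let _ : Fintype L := Fintype.ofFinite L
  let _ : DecidableEq L := Classical.decEq L
  have hc : Fintype.card L = Fintype.card F ^ 2 := by
    rw [← Nat.card_eq_fintype_card, ← Nat.card_eq_fintype_card]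
    exact FiniteField.natCard_extension F p 2
  have hF4 : Fintype.card F % 4 = 1 := by rw [hcF, Nat.pow_mod, hp4]; simp
  have hF : ringChar F ≠ 2 := by
    intro h
    have := FiniteField.even_card_of_char_two h
    omega
  have hcount := hmax F hcF2
  have hS : ∑ x : F, quadraticChar F ((dickson 1 (1 : F) l).eval x) =
      ((l : ℤ) - 1) * ((p ^ n : ℕ) : ℤ) := by
    have h1 := count_eq hF l
    rw [hcount, hcF2] at h1
    push_cast [Nat.cast_sub hl.one_le] at h1
    push_cast
    linarith
  have hpq : p ∣ p ^ n := dvd_pow_self p (by omega)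
  have hQz : ((Fintype.card F : ℕ) : ℤ) = (p : ℤ) ^ (2 * n) := by rw [hcF]; push_cast; rfl
  have hdv : (l : ℤ) ∣ (p : ℤ) ^ (2 * n) - (-1) ^ n := by
    rw [pow_mul]
    refine dvd_trans ?_ (sub_dvd_pow_sub_pow ((p : ℤ) ^ 2) (-1) n)
    simpa using hpl
  rw [← hcF] at hch
  rw [← hQz] at hI hdv
  rcases Nat.even_or_odd n with he | ho
  · rw [he.neg_one_pow] at hI hdv
    refine core_even (F := F) (L := L) p l hl (by omega) (p ^ n) j I hpq hc hcF2 hF4 ?_ hj hjl hI hch hS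
    have := Fintype.card_pos (α := F)
    zify [this]
    exact hdv
  · rw [ho.neg_one_pow, sub_neg_eq_add] at hI hdv
    have : CharP L p := charP_of_injective_algebraMap (algebraMap F L).injective p
    refine core_odd (F := F) (L := L) p l hl (by omega) (p ^ n) j I hpq hc hcF2 hF4 ?_ hj hjl hI hch hS
    zify
    exact hdv
end

section
/- Let ℓ > 5 be a prime with ℓ ≡ 1 (mod 4), and let a be an integer with 0 < a < ℓ/2 and a² ≡ −1 (mod ℓ). Then there exists an integer m with 1 ≤ m ≤ (ℓ−1)/2 such that ⟨⟨m·a⟩⟩ ≡ m (mod 2), where for an integer x not divisible by ℓ, ⟨⟨x⟩⟩ denotes the unique integer r with 1 ≤ r ≤ (ℓ−1)/2 and x ≡ r (mod ℓ) or x ≡ −r (mod ℓ). -/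
open Polynomial

/-- For an integer x not divisible by l, `rep l x` is the unique r with 1 ≤ r ≤ (l-1)/2
and x ≡ r or x ≡ -r (mod l). -/
def rep (l : ℕ) (x : ℤ) : ℕ := min (x % (l : ℤ)).toNat (l - (x % (l : ℤ)).toNat)

theorem statement11 (l : ℕ) (hl : l.Prime) (hl5 : 5 < l) (hl4 : l % 4 = 1)
    (a : ℕ) (ha : 0 < a) (ha2 : 2 * a < l) (hasq : (a : ZMod l) ^ 2 = -1) :
    ∃ m : ℕ, 1 ≤ m ∧ m ≤ (l - 1) / 2 ∧ rep l ((m * a : ℕ) : ℤ) % 2 = m % 2 := by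
  by_cases h1 : a % 2 = 1
  · refine ⟨1, le_refl _, by omega, ?_⟩
    have h : ((1 * a : ℕ) : ℤ) % (l : ℤ) = (a : ℤ) := by
      push_cast
      rw [one_mul]
      exact Int.emod_eq_of_lt (by omega) (by omega)
    unfold rep
    rw [h]
    omega
  by_cases h2 : 4 * a < l
  · refine ⟨2, by omega, by omega, ?_⟩
    have h : ((2 * a : ℕ) : ℤ) % (l : ℤ) = ((2 * a : ℕ) : ℤ) :=
      Int.emod_eq_of_lt (by omega) (by omega)
    unfold rep
    rw [h]
    omega
  refine ⟨3, by omega, by omega, ?_⟩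
  by_cases h3 : 3 * a < l
  · have h : ((3 * a : ℕ) : ℤ) % (l : ℤ) = ((3 * a : ℕ) : ℤ) :=
      Int.emod_eq_of_lt (by omega) (by omega)
    unfold rep
    rw [h]
    omega
  · have h : ((3 * a : ℕ) : ℤ) % (l : ℤ) = ((3 * a : ℕ) : ℤ) - l := by
      rw [← Int.sub_emod_right]
      exact Int.emod_eq_of_lt (by omega) (by omega)
    unfold rep
    rw [h]
    omega
end
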